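/- arXiv:2105.13656 — 4 statements merged into one kernel-verified Lean document; each statement's English description precedes it below -/
import Mathlib

section
/- Let A, E ∈ ℂ^{n×n} be such that the pencil L(s) = A + sE is regular and E is not invertible, let k = dim ker(E) ≥ 1, and let U ∈ ℂ^{n×k} be a matrix whose columns form an orthonormal basis of ker(E) (i.e., UᴴU = I_k and the column space of U equals ker E). Then the distance δ₀(A) := inf{ ‖Δ_A‖ : Δ_A ∈ ℂ^{n×n}, ker(A − Δ_A) ∩ ker(E) ≠ {0} } equals σ_min(AU), the smallest singular value of the n×k matrix AU. -/
open Matrix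

/-- The spectral norm (ℓ² operator norm) of a complex matrix. -/
noncomputable def specNorm {k : Type*} [Fintype k] [DecidableEq k]
    (X : Matrix k k ℂ) : ℝ :=
  ‖Matrix.toEuclideanCLM (𝕜 := ℂ) X‖

/-- The smallest eigenvalue of a Hermitian matrix (junk value `0` otherwise). -/
noncomputable def lamMin {k : Type*} [Fintype k] [DecidableEq k]
    (H : Matrix k k ℂ) : ℝ :=
  if h : H.IsHermitian then ⨅ i, h.eigenvalues i else 0

theorem aux_norm_sq {m : ℕ} (x : Fin m → ℂ) :
    ((‖WithLp.toLp 2 x‖ ^ 2 : ℝ) : ℂ) = star x ⬝ᵥ x := by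
  have h := inner_self_eq_norm_sq_to_K (𝕜 := ℂ) (WithLp.toLp 2 x)
  rw [EuclideanSpace.inner_eq_star_dotProduct] at h
  rw [dotProduct_comm]
  push_cast
  exact h.symm

theorem aux_gram {n k : ℕ} (M : Matrix (Fin n) (Fin k) ℂ) (c : Fin k → ℂ) :
    ((‖WithLp.toLp 2 (M *ᵥ c)‖ ^ 2 : ℝ) : ℂ) = star c ⬝ᵥ ((Mᴴ * M) *ᵥ c) := by
  rw [aux_norm_sq, star_mulVec, ← dotProduct_mulVec, mulVec_mulVec]

theorem aux_lower {k : ℕ} (H : Matrix (Fin k) (Fin k) ℂ) (h : H.IsHermitian)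
    (c : Fin k → ℂ) :
    (⨅ i, h.eigenvalues i) * ‖WithLp.toLp 2 c‖ ^ 2 ≤ (star c ⬝ᵥ (H *ᵥ c)).re := by
  set b := h.eigenvectorBasis
  set x : EuclideanSpace ℂ (Fin k) := WithLp.toLp 2 c with hx
  have h1 : star c ⬝ᵥ (H *ᵥ c) = ((∑ i, h.eigenvalues i * ‖inner ℂ (b i) x‖ ^ 2 : ℝ) : ℂ) := by
    have e1 : star c ⬝ᵥ (H *ᵥ c) = inner ℂ x (WithLp.toLp 2 (H *ᵥ c)) := by
      rw [EuclideanSpace.inner_eq_star_dotProduct, dotProduct_comm]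
    rw [e1, ← b.sum_inner_mul_inner]
    push_cast
    refine Finset.sum_congr rfl fun i _ => ?_
    have e2 : inner ℂ (b i) (WithLp.toLp 2 (H *ᵥ c)) = h.eigenvalues i * inner ℂ (b i) x := by
      have e3 := h.mulVec_eigenvectorBasis i
      rw [EuclideanSpace.inner_eq_star_dotProduct, EuclideanSpace.inner_eq_star_dotProduct,
        dotProduct_comm, dotProduct_mulVec]
      have e4 : star (b i).ofLp ᵥ* H = star (H *ᵥ (b i).ofLp) := by
        rw [star_mulVec, h.eq]
      rw [e4]
      change star (H *ᵥ (h.eigenvectorBasis i).ofLp) ⬝ᵥ c = _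
      rw [e3]
      simp [hx, dotProduct_comm, b]
    rw [e2]
    have e5 : inner ℂ x (b i) = star (inner ℂ (b i) x) := (inner_conj_symm x (b i)).symm
    rw [e5]
    have := RCLike.conj_mul (inner ℂ (b i) x : ℂ)
    simp only [RCLike.star_def] at *
    rw [mul_left_comm, this]
    rfl
  rw [h1, Complex.ofReal_re, ← b.sum_sq_norm_inner_right x, Finset.mul_sum]
  refine Finset.sum_le_sum fun i _ => ?_
  gcongr
  exact ciInf_le (Set.finite_range _).bddBelow i

theorem aux_toCLM {n : ℕ} (D : Matrix (Fin n) (Fin n) ℂ) (v : Fin n → ℂ) :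
    Matrix.toEuclideanCLM (𝕜 := ℂ) D (WithLp.toLp 2 v) = WithLp.toLp 2 (D *ᵥ v) := by
  simp

/-- If `E` is singular and the columns of `U` form an orthonormal basis of `ker E`,
then `δ₀(A) = σ_min(AU)`, the smallest singular value of `AU`. -/
theorem distance_to_common_null_space_perturbing_A
    {n k : ℕ} (A E : Matrix (Fin n) (Fin n) ℂ)
    (hreg : ∃ l : ℂ, (A + l • E).det ≠ 0)
    (hE : ¬ IsUnit E)
    (hk : 1 ≤ k)
    (U : Matrix (Fin n) (Fin k) ℂ)
    (hUorth : Uᴴ * U = 1)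
    (hUspan : ∀ v : Fin n → ℂ, E.mulVec v = 0 ↔ ∃ c : Fin k → ℂ, v = U.mulVec c) :
    sInf {r : ℝ | ∃ (DA : Matrix (Fin n) (Fin n) ℂ) (v : Fin n → ℂ),
        v ≠ 0 ∧ (A - DA).mulVec v = 0 ∧ E.mulVec v = 0 ∧ r = specNorm DA} =
      Real.sqrt (lamMin ((A * U)ᴴ * (A * U))) := by
  have h : ((A * U)ᴴ * (A * U)).IsHermitian := isHermitian_conjTranspose_mul_self _
  have hlam : lamMin ((A * U)ᴴ * (A * U)) = ⨅ i, h.eigenvalues i := by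
    rw [lamMin, dif_pos h]
  have hU : ∀ c : Fin k → ℂ, ‖WithLp.toLp 2 (U *ᵥ c)‖ ^ 2 = ‖WithLp.toLp 2 c‖ ^ 2 := by
    intro c
    have := aux_gram U c
    rw [hUorth, one_mulVec, ← aux_norm_sq] at this
    exact_mod_cast this
  have : Nonempty (Fin k) := ⟨⟨0, hk⟩⟩
  have lower : ∀ (DA : Matrix (Fin n) (Fin n) ℂ) (v : Fin n → ℂ),
      v ≠ 0 → (A - DA).mulVec v = 0 → E.mulVec v = 0 →
      Real.sqrt (lamMin ((A * U)ᴴ * (A * U))) ≤ specNorm DA := by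
    intro DA v hv hA hEv
    obtain ⟨c, rfl⟩ := (hUspan v).1 hEv
    have h1 := aux_lower _ h c
    rw [← aux_gram, Complex.ofReal_re, ← hU, ← mulVec_mulVec] at h1
    rw [sub_mulVec, sub_eq_zero] at hA
    rw [hA, ← aux_toCLM] at h1
    have hpos : 0 < ‖WithLp.toLp 2 (U *ᵥ c)‖ := by
      rw [norm_pos_iff]
      intro h0
      exact hv (by simpa using h0)
    have h2 := (Matrix.toEuclideanCLM (𝕜 := ℂ) DA).le_opNorm (WithLp.toLp 2 (U *ᵥ c))
    have h0 : 0 ≤ specNorm DA := norm_nonneg _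
    refine Real.sqrt_le_iff.2 ⟨h0, ?_⟩
    rw [hlam]
    have h3 := h1.trans (pow_le_pow_left₀ (norm_nonneg _) h2 2)
    rw [mul_pow] at h3
    exact le_of_mul_le_mul_right h3 (by positivity)
  obtain ⟨i, hi⟩ := exists_eq_ciInf_of_finite (f := h.eigenvalues)
  set c : Fin k → ℂ := (h.eigenvectorBasis i).ofLp with hc
  have hcn : ‖WithLp.toLp 2 c‖ = 1 := h.eigenvectorBasis.orthonormal.1 i
  have hAv : ‖WithLp.toLp 2 (A *ᵥ (U *ᵥ c))‖ ^ 2 = h.eigenvalues i := by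
    have h1 := aux_gram (A * U) c
    rw [hc, h.mulVec_eigenvectorBasis i, ← hc, dotProduct_smul, ← aux_norm_sq, hcn] at h1
    rw [mulVec_mulVec]
    have h2 := congrArg Complex.re h1
    rw [Complex.ofReal_re] at h2
    rw [h2]
    simp
  have hvn : ‖WithLp.toLp 2 (U *ᵥ c)‖ ^ 2 = 1 := by rw [hU, hcn]; norm_num
  set v := U *ᵥ c with hv
  have hvv : star v ⬝ᵥ v = 1 := by rw [← aux_norm_sq, hvn]; simp
  have hv1 : ‖WithLp.toLp 2 v‖ = 1 := by
    nlinarith [norm_nonneg (WithLp.toLp 2 v)]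
  have hle : specNorm (vecMulVec (A *ᵥ v) (star v)) ≤
      Real.sqrt (lamMin ((A * U)ᴴ * (A * U))) := by
    rw [hlam, ← hi, ← hAv, Real.sqrt_sq (norm_nonneg _)]
    refine ContinuousLinearMap.opNorm_le_bound _ (norm_nonneg _) fun w => ?_
    have e : Matrix.toEuclideanCLM (𝕜 := ℂ) (vecMulVec (A *ᵥ v) (star v)) w =
        (star v ⬝ᵥ w.ofLp) • WithLp.toLp 2 (A *ᵥ v) := by
      have := aux_toCLM (vecMulVec (A *ᵥ v) (star v)) w.ofLp
      rw [vecMulVec_mulVec] at this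
      rw [← WithLp.toLp_smul, ← op_smul_eq_smul]
      exact this
    rw [e, norm_smul, mul_comm]
    gcongr
    have := norm_inner_le_norm (𝕜 := ℂ) (WithLp.toLp 2 v) w
    rw [EuclideanSpace.inner_eq_star_dotProduct, hv1, one_mul, dotProduct_comm] at this
    exact this
  have hmem : specNorm (vecMulVec (A *ᵥ v) (star v)) ∈ {r : ℝ | ∃ (DA : Matrix (Fin n) (Fin n) ℂ) (v : Fin n → ℂ),
        v ≠ 0 ∧ (A - DA).mulVec v = 0 ∧ E.mulVec v = 0 ∧ r = specNorm DA} := by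
    refine ⟨_, v, ?_, ?_, (hUspan v).2 ⟨c, rfl⟩, rfl⟩
    · intro h0
      rw [h0] at hvv
      simp at hvv
    · rw [sub_mulVec, vecMulVec_mulVec, hvv]
      simp
  refine le_antisymm ((csInf_le ⟨0, ?_⟩ hmem).trans hle) (le_csInf ⟨_, hmem⟩ ?_)
  · rintro r ⟨D, w, -, -, -, rfl⟩
    exact norm_nonneg _
  · rintro r ⟨D, w, h1, h2, h3, rfl⟩
    exact lower D w h1 h2 h3
end

section
/- Let A, E ∈ ℂ^{n×n} be Hermitian matrices such that the pencil L(s) = A + sE is regular. Then the Hermitian structured distance to a common null space equals the unstructured one: the infimum of √(‖Δ_A‖² + ‖Δ_E‖²) over all pairs of Hermitian matrices (Δ_A, Δ_E) for which there exists a nonzero v ∈ ℂⁿ with (A − Δ_A)v = 0 and (E − Δ_E)v = 0 equals √(λ_min(AᴴA + EᴴE)), which is also the value of the infimum taken over all (not necessarily Hermitian) pairs (Δ_A, Δ_E) ∈ ℂ^{n×n} × ℂ^{n×n}. -/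
open Matrix

open scoped InnerProductSpace

/-- Norm-preserving self-adjoint mapping: if `⟪v, w⟫` is symmetric, some self-adjoint operator of
norm at most `‖w‖` takes the unit vector `v` to `w`. -/
lemma exists_selfAdjoint_map {F : Type*} [NormedAddCommGroup F] [InnerProductSpace ℂ F]
    [CompleteSpace F] (v w : F) (hv : ‖v‖ = 1) (h : ⟪v, w⟫_ℂ = ⟪w, v⟫_ℂ) :
    ∃ T : F →L[ℂ] F, IsSelfAdjoint T ∧ T v = w ∧ ‖T‖ ≤ ‖w‖ := by
  by_cases hw : w = 0
  · exact ⟨0, IsSelfAdjoint.zero _, by simp [hw], by simp⟩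
  have hc : ‖w‖ ≠ 0 := norm_ne_zero_iff.mpr hw
  obtain ⟨u, hu⟩ : ∃ u : F, u = ((‖w‖ : ℂ))⁻¹ • w := ⟨_, rfl⟩
  have hcC : (‖w‖ : ℂ) ≠ 0 := by exact_mod_cast hc
  have hwu : w = (‖w‖ : ℂ) • u := by rw [hu, smul_smul, mul_inv_cancel₀ hcC, one_smul]
  have hun : ‖u‖ = 1 := by
    rw [hu, norm_smul]; simp [hc]
  have hvu : ⟪v, u⟫_ℂ = ⟪u, v⟫_ℂ := by
    rw [hu, inner_smul_left, inner_smul_right, h]; simp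
  let K : Submodule ℂ F := (Submodule.span ℂ {v - u})ᗮ
  have h1 : K.reflection (v - u) = -(v - u) :=
    Submodule.reflection_orthogonalComplement_singleton_eq_neg (v - u)
  have h2 : K.reflection (v + u) = v + u := by
    apply Submodule.reflection_mem_subspace_eq_self
    rw [Submodule.mem_orthogonal_singleton_iff_inner_left]
    rw [inner_add_left, inner_sub_right, inner_sub_right, hvu,
      inner_self_eq_norm_sq_to_K, inner_self_eq_norm_sq_to_K, hv, hun]
    ring
  have h3 : K.reflection v = u := by
    have e : (2 : ℂ) • K.reflection v = (2 : ℂ) • u := by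
      have : (2 : ℂ) • v = (v + u) + (v - u) := by rw [two_smul]; abel
      rw [← map_smul, this, map_add, h1, h2, two_smul]; abel
    exact smul_right_injective F (two_ne_zero : (2 : ℂ) ≠ 0) e
  have h4 : ∀ x, ((2 : ℝ) • K.starProjection - 1) x = K.reflection x := by
    intro x
    rw [Submodule.reflection_apply]
    simp [two_smul]
  refine ⟨‖w‖ • ((2 : ℝ) • K.starProjection - 1), ?_, ?_, ?_⟩
  · refine IsSelfAdjoint.smul (IsSelfAdjoint.all _) (IsSelfAdjoint.sub ?_ (IsSelfAdjoint.one _))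
    exact IsSelfAdjoint.smul (IsSelfAdjoint.all _) (isSelfAdjoint_starProjection K)
  · rw [_root_.smul_apply, h4, h3]
    conv_rhs => rw [hwu]
    simp
  · refine ContinuousLinearMap.opNorm_le_bound _ (norm_nonneg _) fun x => ?_
    rw [_root_.smul_apply, h4, norm_smul, LinearIsometryEquiv.norm_map, norm_norm]

lemma exists_hermitian_map {n : ℕ} (A : Matrix (Fin n) (Fin n) ℂ) (hA : A.IsHermitian)
    (v : EuclideanSpace ℂ (Fin n)) (hv : ‖v‖ = 1) :
    ∃ D : Matrix (Fin n) (Fin n) ℂ, D.IsHermitian ∧ (A - D).mulVec v.ofLp = 0 ∧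
      specNorm D ≤ ‖toEuclideanCLM (𝕜 := ℂ) A v‖ := by
  have hsa : IsSelfAdjoint (toEuclideanCLM (𝕜 := ℂ) A) := by
    rw [isSelfAdjoint_iff, ← map_star]; congr 1
  have hs := ContinuousLinearMap.isSelfAdjoint_iff_isSymmetric.mp hsa
  obtain ⟨T, hT, hTv, hTn⟩ := exists_selfAdjoint_map v (toEuclideanCLM (𝕜 := ℂ) A v) hv
    (hs v v).symm
  refine ⟨(toEuclideanCLM (n := Fin n) (𝕜 := ℂ)).symm T, ?_, ?_, ?_⟩
  · change star _ = _
    apply EquivLike.injective (toEuclideanCLM (n := Fin n) (𝕜 := ℂ))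
    rw [map_star, StarAlgEquiv.apply_symm_apply, hT.star_eq]
  · rw [← ofLp_toEuclideanCLM, map_sub]
    simp [hTv]
  · simpa [specNorm] using hTn

lemma inner_gram {n : ℕ} (A E : Matrix (Fin n) (Fin n) ℂ) (v : EuclideanSpace ℂ (Fin n)) :
    ⟪v, toEuclideanCLM (𝕜 := ℂ) (Aᴴ * A + Eᴴ * E) v⟫_ℂ =
      ((‖toEuclideanCLM (𝕜 := ℂ) A v‖ ^ 2 + ‖toEuclideanCLM (𝕜 := ℂ) E v‖ ^ 2 : ℝ) : ℂ) := by
  rw [map_add, map_mul, map_mul, ← star_eq_conjTranspose, ← star_eq_conjTranspose, map_star,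
    map_star, ContinuousLinearMap.star_eq_adjoint, ContinuousLinearMap.star_eq_adjoint]
  rw [_root_.add_apply, inner_add_right, ContinuousLinearMap.mul_def,
    ContinuousLinearMap.mul_def, ContinuousLinearMap.comp_apply, ContinuousLinearMap.comp_apply, ContinuousLinearMap.adjoint_inner_right,
    ContinuousLinearMap.adjoint_inner_right, inner_self_eq_norm_sq_to_K,
    inner_self_eq_norm_sq_to_K]
  push_cast
  rfl

lemma clm_eigenvectorBasis {n : ℕ} {H : Matrix (Fin n) (Fin n) ℂ} (hH : H.IsHermitian)
    (i : Fin n) : toEuclideanCLM (𝕜 := ℂ) H (hH.eigenvectorBasis i) =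
      (hH.eigenvalues i : ℂ) • hH.eigenvectorBasis i := by
  apply WithLp.ofLp_injective
  rw [ofLp_toEuclideanCLM, hH.mulVec_eigenvectorBasis]
  simp

lemma rayleigh_le {n : ℕ} {H : Matrix (Fin n) (Fin n) ℂ} (hH : H.IsHermitian) (m r : ℝ)
    (hm : ∀ i, m ≤ hH.eigenvalues i) (v : EuclideanSpace ℂ (Fin n))
    (hr : ⟪v, toEuclideanCLM (𝕜 := ℂ) H v⟫_ℂ = r) : m * ‖v‖ ^ 2 ≤ r := by
  have hsa : IsSelfAdjoint (toEuclideanCLM (𝕜 := ℂ) H) := by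
    rw [isSelfAdjoint_iff, ← map_star]; congr 1
  have hs := ContinuousLinearMap.isSelfAdjoint_iff_isSymmetric.mp hsa
  have key : r = ∑ i, hH.eigenvalues i * ‖⟪hH.eigenvectorBasis i, v⟫_ℂ‖ ^ 2 := by
    apply Complex.ofReal_injective
    rw [← hr, ← hH.eigenvectorBasis.sum_inner_mul_inner]
    push_cast
    refine Finset.sum_congr rfl fun i _ => ?_
    have := hs (hH.eigenvectorBasis i) v
    simp only [ContinuousLinearMap.coe_coe] at this
    rw [← this, clm_eigenvectorBasis, inner_smul_left, ← inner_conj_symm v]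
    rw [Complex.conj_ofReal, mul_left_comm, Complex.conj_mul']
  rw [key, ← hH.eigenvectorBasis.sum_sq_norm_inner_right v, Finset.mul_sum]
  exact Finset.sum_le_sum fun i _ => mul_le_mul_of_nonneg_right (hm i) (sq_nonneg _)

lemma norm_le_of_sub {n : ℕ} (A D : Matrix (Fin n) (Fin n) ℂ) (v : Fin n → ℂ)
    (h : (A - D).mulVec v = 0) :
    ‖toEuclideanCLM (𝕜 := ℂ) A (WithLp.toLp 2 v)‖ ≤ specNorm D * ‖WithLp.toLp 2 v‖ := by
  have : A.mulVec v = D.mulVec v := by rwa [sub_mulVec, sub_eq_zero] at h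
  rw [toEuclideanCLM_toLp, this, ← toEuclideanCLM_toLp]
  exact ContinuousLinearMap.le_opNorm _ _

lemma gram_isHermitian {n : ℕ} (A E : Matrix (Fin n) (Fin n) ℂ) :
    (Aᴴ * A + Eᴴ * E).IsHermitian :=
  (isHermitian_conjTranspose_mul_self A).add (isHermitian_conjTranspose_mul_self E)

lemma lower_bound {n : ℕ} (A E DA DE : Matrix (Fin n) (Fin n) ℂ) (v : Fin n → ℂ) (hv : v ≠ 0)
    (h1 : (A - DA).mulVec v = 0) (h2 : (E - DE).mulVec v = 0) :
    Real.sqrt (lamMin (Aᴴ * A + Eᴴ * E)) ≤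
      Real.sqrt (specNorm DA ^ 2 + specNorm DE ^ 2) := by
  apply Real.sqrt_le_sqrt
  have hH := gram_isHermitian A E
  rw [lamMin, dif_pos hH]
  have hb := rayleigh_le hH (⨅ i, hH.eigenvalues i) _
    (fun i => ciInf_le (Set.finite_range _).bddBelow i) (WithLp.toLp 2 v) (inner_gram A E _)
  have e1 := pow_le_pow_left₀ (norm_nonneg _) (norm_le_of_sub A DA v h1) 2
  have e2 := pow_le_pow_left₀ (norm_nonneg _) (norm_le_of_sub E DE v h2) 2
  have hpos : 0 < ‖(WithLp.toLp 2 v : EuclideanSpace ℂ (Fin n))‖ ^ 2 := by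
    have : (WithLp.toLp 2 v : EuclideanSpace ℂ (Fin n)) ≠ 0 := by simpa using hv
    positivity
  refine le_of_mul_le_mul_right ?_ hpos
  rw [mul_pow] at e1 e2
  linarith

lemma upper_bound {n : ℕ} [NeZero n] (A E : Matrix (Fin n) (Fin n) ℂ) (hA : A.IsHermitian)
    (hE : E.IsHermitian) :
    ∃ (DA DE : Matrix (Fin n) (Fin n) ℂ) (v : Fin n → ℂ),
        DA.IsHermitian ∧ DE.IsHermitian ∧
        v ≠ 0 ∧ (A - DA).mulVec v = 0 ∧ (E - DE).mulVec v = 0 ∧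
        Real.sqrt (specNorm DA ^ 2 + specNorm DE ^ 2) ≤
          Real.sqrt (lamMin (Aᴴ * A + Eᴴ * E)) := by
  have hH := gram_isHermitian A E
  obtain ⟨i, hi⟩ := exists_eq_ciInf_of_finite (f := hH.eigenvalues)
  have hv : ‖hH.eigenvectorBasis i‖ = 1 := hH.eigenvectorBasis.norm_eq_one i
  obtain ⟨DA, a1, a2, a3⟩ := exists_hermitian_map A hA _ hv
  obtain ⟨DE, b1, b2, b3⟩ := exists_hermitian_map E hE _ hv
  refine ⟨DA, DE, _, a1, b1, ?_, a2, b2, ?_⟩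
  · intro h0
    have : hH.eigenvectorBasis i = 0 := WithLp.ofLp_injective _ h0
    rw [this] at hv
    simp at hv
  · apply Real.sqrt_le_sqrt
    rw [lamMin, dif_pos hH, ← hi]
    have hg := inner_gram A E (hH.eigenvectorBasis i)
    rw [clm_eigenvectorBasis, inner_smul_right, inner_self_eq_norm_sq_to_K, hv] at hg
    have hg' : hH.eigenvalues i = ‖toEuclideanCLM (𝕜 := ℂ) A (hH.eigenvectorBasis i)‖ ^ 2 +
        ‖toEuclideanCLM (𝕜 := ℂ) E (hH.eigenvectorBasis i)‖ ^ 2 :=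
      Complex.ofReal_injective (by simpa using hg)
    rw [hg']
    have p1 : 0 ≤ specNorm DA := norm_nonneg _
    have p2 : 0 ≤ specNorm DE := norm_nonneg _
    gcongr

/-- For a regular Hermitian pencil the structured distance to a common null space
equals `√(λ_min(AᴴA + EᴴE))`, which is also the unstructured distance. -/
theorem hermitian_distance_to_common_null_space
    {n : ℕ} (A E : Matrix (Fin n) (Fin n) ℂ)
    (hA : A.IsHermitian) (hE : E.IsHermitian)
    (hreg : ∃ l : ℂ, (A + l • E).det ≠ 0) :
    sInf {r : ℝ | ∃ (DA DE : Matrix (Fin n) (Fin n) ℂ) (v : Fin n → ℂ),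
        DA.IsHermitian ∧ DE.IsHermitian ∧
        v ≠ 0 ∧ (A - DA).mulVec v = 0 ∧ (E - DE).mulVec v = 0 ∧
        r = Real.sqrt (specNorm DA ^ 2 + specNorm DE ^ 2)} =
      Real.sqrt (lamMin (Aᴴ * A + Eᴴ * E)) ∧
    sInf {r : ℝ | ∃ (DA DE : Matrix (Fin n) (Fin n) ℂ) (v : Fin n → ℂ),
        v ≠ 0 ∧ (A - DA).mulVec v = 0 ∧ (E - DE).mulVec v = 0 ∧
        r = Real.sqrt (specNorm DA ^ 2 + specNorm DE ^ 2)} =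
      Real.sqrt (lamMin (Aᴴ * A + Eᴴ * E)) := by
  rcases Nat.eq_zero_or_pos n with rfl | hn
  · have hz : ∀ v : Fin 0 → ℂ, v = 0 := fun v => Subsingleton.elim _ _
    have hl : lamMin (Aᴴ * A + Eᴴ * E) = 0 := by
      rw [lamMin, dif_pos (gram_isHermitian A E), Real.iInf_of_isEmpty]
    have hne : ∀ v : Fin 0 → ℂ, ¬ v ≠ 0 := fun v h => h (hz v)
    rw [hl]
    simp only [hne, false_and, and_false, exists_false, Set.ofPred_false, Real.sInf_empty,
      Real.sqrt_zero, and_self]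
  · have : NeZero n := ⟨hn.ne'⟩
    obtain ⟨DA, DE, v, h1, h2, h3, h4, h5, h6⟩ := upper_bound A E hA hE
    constructor
    · apply le_antisymm
      · refine le_trans (csInf_le ⟨0, ?_⟩ ⟨DA, DE, v, h1, h2, h3, h4, h5, rfl⟩) h6
        rintro r ⟨_, _, _, _, _, _, _, _, rfl⟩
        exact Real.sqrt_nonneg _
      · refine le_csInf ⟨_, DA, DE, v, h1, h2, h3, h4, h5, rfl⟩ ?_
        rintro r ⟨_, _, _, _, _, k3, k4, k5, rfl⟩
        exact lower_bound A E _ _ _ k3 k4 k5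
    · apply le_antisymm
      · refine le_trans (csInf_le ⟨0, ?_⟩ ⟨DA, DE, v, h3, h4, h5, rfl⟩) h6
        rintro r ⟨_, _, _, _, _, _, rfl⟩
        exact Real.sqrt_nonneg _
      · refine le_csInf ⟨_, DA, DE, v, h3, h4, h5, rfl⟩ ?_
        rintro r ⟨_, _, _, k3, k4, k5, rfl⟩
        exact lower_bound A E _ _ _ k3 k4 k5
end

section
/- Let A ∈ ℂ^{n×n} be such that the *-palindromic pencil L(s) = A + sAᴴ is regular. Then the square of the structured distance to a common null space satisfies δ₀^{pal*}(A,Aᴴ)² = 2 · sup_{γ ∈ [0,1]} λ_min( AAᴴ + γ(AᴴA − AAᴴ) ), where δ₀^{pal*}(A,Aᴴ) is the infimum of √(‖Δ‖² + ‖Δᴴ‖²) over all Δ ∈ ℂ^{n×n} for which there exists a nonzero v ∈ ℂⁿ with (A − Δ)v = 0 and (Aᴴ − Δᴴ)v = 0. -/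
open Matrix

open scoped InnerProductSpace

/-- Convexity-type lemma for two real quadratic forms. -/
lemma quad_common {E : Type*} [NormedAddCommGroup E] [NormedSpace ℝ E] [ProperSpace E]
    (h g : E → ℝ) (H G : E → E → ℝ) (hc : Continuous h) (gc : Continuous g)
    (hH : ∀ (a b : ℝ) x y, h (a • x + b • y) = a ^ 2 * h x + b ^ 2 * h y + a * b * H x y)
    (gG : ∀ (a b : ℝ) x y, g (a • x + b • y) = a ^ 2 * g x + b ^ 2 * g y + a * b * G x y)
    (hex : ∀ γ ∈ Set.Icc (0 : ℝ) 1, ∃ v : E, ‖v‖ = 1 ∧ (1 - γ) * h v + γ * g v ≤ 0) :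
    ∃ v : E, v ≠ 0 ∧ h v ≤ 0 ∧ g v ≤ 0 := by
  have hs : ∀ (a : ℝ) x, h (a • x) = a ^ 2 * h x := fun a x => by
    have := hH a 0 x x
    simpa using this
  have gs : ∀ (a : ℝ) x, g (a • x) = a ^ 2 * g x := fun a x => by
    have := gG a 0 x x
    simpa using this
  have ne : ∀ v : E, ‖v‖ = 1 → v ≠ 0 := by
    rintro v hv rfl
    simp at hv
  -- closed sets of parameters
  have closedΓ : ∀ f : E → ℝ, Continuous f → IsClosed {γ : ℝ | ∃ v : E, ‖v‖ = 1 ∧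
      f v ≤ 0 ∧ (1 - γ) * h v + γ * g v ≤ 0} := by
    intro f fc
    have hK : IsCompact (Metric.sphere (0 : E) 1) := isCompact_sphere 0 1
    have : CompactSpace (Metric.sphere (0 : E) 1) := isCompact_iff_compactSpace.mp hK
    have hcl : IsClosed {p : Metric.sphere (0 : E) 1 × ℝ |
        f p.1 ≤ 0 ∧ (1 - p.2) * h p.1 + p.2 * g p.1 ≤ 0} := by
      have c1 : Continuous fun p : Metric.sphere (0 : E) 1 × ℝ => f p.1 := by fun_prop
      have c2 : Continuous fun p : Metric.sphere (0 : E) 1 × ℝ =>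
          (1 - p.2) * h p.1 + p.2 * g p.1 := by fun_prop
      exact (isClosed_le c1 continuous_const).inter (isClosed_le c2 continuous_const)
    have := isClosedMap_snd_of_compactSpace _ hcl
    convert this using 1
    ext γ
    constructor
    · rintro ⟨v, hv, h1, h2⟩
      exact ⟨(⟨v, by simpa using hv⟩, γ), ⟨h1, h2⟩, rfl⟩
    · rintro ⟨⟨⟨v, hv⟩, γ'⟩, ⟨h1, h2⟩, rfl⟩
      exact ⟨v, by simpa using hv, h1, h2⟩
  have hpre := isPreconnected_closed_iff.mp (isPreconnected_Icc (a := (0 : ℝ)) (b := 1))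
  obtain ⟨γ, hγ, ⟨v1, hv1, hh1, hF1⟩, ⟨v2, hv2, hg2, hF2⟩⟩ :=
    hpre _ _ (closedΓ h hc) (closedΓ g gc)
    (by
      intro γ hγ
      obtain ⟨v, hv, hF⟩ := hex γ hγ
      by_cases hh : h v ≤ 0
      · exact Or.inl ⟨v, hv, hh, hF⟩
      · refine Or.inr ⟨v, hv, ?_, hF⟩
        by_contra hg
        push Not at hh hg
        rcases eq_or_lt_of_le hγ.1 with h0 | h0
        · subst h0; linarith
        · have := mul_pos h0 hg
          have := mul_nonneg (sub_nonneg.mpr hγ.2) hh.le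
          linarith)
    (by
      obtain ⟨v, hv, hF⟩ := hex 0 (by simp)
      exact ⟨0, by simp, v, hv, by simpa using hF, hF⟩)
    (by
      obtain ⟨v, hv, hF⟩ := hex 1 (by simp)
      exact ⟨1, by simp, v, hv, by simpa using hF, hF⟩)
  -- choose a sign
  obtain ⟨u, hu, hcross⟩ : ∃ u : ℝ, u ^ 2 = 1 ∧ u * ((1 - γ) * H v1 v2 + γ * G v1 v2) ≤ 0 := by
    rcases le_total ((1 - γ) * H v1 v2 + γ * G v1 v2) 0 with hle | hle
    · exact ⟨1, by norm_num, by linarith⟩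
    · exact ⟨-1, by norm_num, by linarith⟩
  let p : ℝ → E := fun s => (1 - s) • v1 + (s * u) • v2
  have pc : Continuous p := by fun_prop
  have hF : ∀ s ∈ Set.Icc (0 : ℝ) 1, (1 - γ) * h (p s) + γ * g (p s) ≤ 0 := by
    intro s hs
    have e : (1 - γ) * h (p s) + γ * g (p s) =
        (1 - s) ^ 2 * ((1 - γ) * h v1 + γ * g v1) + s ^ 2 * ((1 - γ) * h v2 + γ * g v2)
        + (1 - s) * s * (u * ((1 - γ) * H v1 v2 + γ * G v1 v2)) := by
      simp only [p, hH, gG]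
      rw [mul_pow s u, hu]
      ring
    rw [e]
    have a1 := mul_nonneg (sq_nonneg (1 - s)) (neg_nonneg.mpr hF1)
    have a2 := mul_nonneg (sq_nonneg s) (neg_nonneg.mpr hF2)
    have a3 := mul_nonneg (mul_nonneg (sub_nonneg.mpr hs.2) hs.1) (neg_nonneg.mpr hcross)
    linarith
  obtain ⟨s, hs01, hs1, hs2⟩ := hpre {s | h (p s) ≤ 0} {s | g (p s) ≤ 0}
    (isClosed_le (by fun_prop) continuous_const) (isClosed_le (by fun_prop) continuous_const)
    (by
      intro s hs
      have hF := hF s hs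
      by_cases hh : h (p s) ≤ 0
      · exact Or.inl hh
      · refine Or.inr ?_
        by_contra hg
        simp only [Set.mem_ofPred_eq] at hg
        push Not at hh hg
        rcases eq_or_lt_of_le hγ.1 with h0 | h0
        · rw [← h0] at hF; linarith
        · have := mul_pos h0 hg
          have := mul_nonneg (sub_nonneg.mpr hγ.2) hh.le
          linarith)
    ⟨0, by simp, by simpa [p] using hh1⟩
    ⟨1, by simp, by simpa [p, gs, hu] using hg2⟩
  by_cases h0 : p s = 0
  · -- the two vectors are proportional
    have hu0 : u ≠ 0 := by rintro rfl; norm_num at hu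
    have hs0 : 1 - s ≠ 0 := by
      intro h1
      have : s = 1 := by linarith
      subst this
      have := ne v2 hv2
      simp_all [p]
    have e1 : v1 = (-(s * u) / (1 - s)) • v2 := by
      have : (1 - s) • v1 = (-(s * u)) • v2 := by
        rw [neg_smul]; exact eq_neg_of_add_eq_zero_left h0
      rw [div_eq_inv_mul, mul_smul, ← this, smul_smul, inv_mul_cancel₀ hs0, one_smul]
    refine ⟨v1, ne v1 hv1, hh1, ?_⟩
    rw [e1, gs]
    exact mul_nonpos_of_nonneg_of_nonpos (sq_nonneg _) hg2
  · exact ⟨p s, h0, hs1, hs2⟩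

section completion
variable {E : Type*} [NormedAddCommGroup E] [InnerProductSpace ℂ E] [CompleteSpace E]

/-- Two-by-two completion, first case. -/
lemma completion_aux (v x y : E) (hv : ‖v‖ = 1) (hxy : ⟪v, x⟫_ℂ = ⟪y, v⟫_ℂ)
    (hle : ‖y‖ ≤ ‖x‖) :
    ∃ D : E →L[ℂ] E, D v = x ∧ ContinuousLinearMap.adjoint D v = y ∧ ‖D‖ ≤ ‖x‖ := by
  set α : ℂ := ⟪v, x⟫_ℂ with hα
  have hvv : ⟪v, v⟫_ℂ = 1 := by simp [inner_self_eq_norm_sq_to_K, hv]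
  have hxv : ⟪x, v⟫_ℂ = (starRingEnd ℂ) α := by rw [hα, inner_conj_symm]
  have hvy : ⟪v, y⟫_ℂ = (starRingEnd ℂ) α := by rw [hxy, inner_conj_symm]
  set x' : E := x - α • v with hx'
  set y' : E := y - (starRingEnd ℂ α) • v with hy'
  have vx' : ⟪v, x'⟫_ℂ = 0 := by rw [hx', inner_sub_right, inner_smul_right, hvv, ← hα]; ring
  have vy' : ⟪v, y'⟫_ℂ = 0 := by rw [hy', inner_sub_right, inner_smul_right, hvv, hvy]; ring
  have x'v : ⟪x', v⟫_ℂ = 0 := inner_eq_zero_symm.mp vx'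
  have y'v : ⟪y', v⟫_ℂ = 0 := inner_eq_zero_symm.mp vy'
  have hx2 : ‖x‖ ^ 2 = ‖α‖ ^ 2 + ‖x'‖ ^ 2 := by
    have e : x = α • v + x' := by simp [hx']
    have := norm_add_sq_eq_norm_sq_add_norm_sq_of_inner_eq_zero (α • v) x'
      (by rw [inner_smul_left, vx', mul_zero])
    rw [← e, norm_smul, hv] at this
    nlinarith
  have hy2 : ‖y‖ ^ 2 = ‖α‖ ^ 2 + ‖y'‖ ^ 2 := by
    have e : y = (starRingEnd ℂ α) • v + y' := by simp [hy']
    have := norm_add_sq_eq_norm_sq_add_norm_sq_of_inner_eq_zero (starRingEnd ℂ α • v) y'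
      (by rw [inner_smul_left, vy', mul_zero])
    rw [← e, norm_smul, hv, RCLike.norm_conj] at this
    nlinarith
  have hle' : ‖y'‖ ^ 2 ≤ ‖x'‖ ^ 2 := by
    have := pow_le_pow_left₀ (norm_nonneg y) hle 2
    linarith
  set β : ℂ := -(starRingEnd ℂ α) / ((‖x'‖ ^ 2 : ℝ) : ℂ) with hβ
  set w : E := v + β • x' with hw
  let D : E →L[ℂ] E := (innerSL ℂ v).smulRight x + (innerSL ℂ y').smulRight w
  have Dap : ∀ z, D z = ⟪v, z⟫_ℂ • x + ⟪y', z⟫_ℂ • w := fun z => by simp [D]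
  refine ⟨D, ?_, ?_, ?_⟩
  · rw [Dap, hvv, y'v]; simp
  · refine ext_inner_right ℂ fun z => ?_
    rw [ContinuousLinearMap.adjoint_inner_left, Dap, inner_add_right, inner_smul_right,
      inner_smul_right, ← hα, hw, inner_add_right, inner_smul_right, vx', hvv]
    have e : y = (starRingEnd ℂ α) • v + y' := by simp [hy']
    rw [e, inner_add_left, inner_smul_left]
    simp
    ring
  · refine ContinuousLinearMap.opNorm_le_bound _ (norm_nonneg x) fun z => ?_
    refine le_of_sq_le_sq ?_ (by positivity) 
    by_cases hx0 : ‖x'‖ = 0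
    · have hy0 : y' = 0 := by
        rw [hx0] at hle'
        have : ‖y'‖ = 0 := by nlinarith [norm_nonneg y']
        simpa using this
      have : ‖⟪v, z⟫_ℂ‖ ≤ ‖z‖ := by simpa [hv] using norm_inner_le_norm (𝕜 := ℂ) v z
      rw [Dap, hy0]
      simp only [inner_zero_left, zero_smul, add_zero, norm_smul]
      rw [mul_comm]
      gcongr
    · have hx0' : ((‖x'‖ ^ 2 : ℝ) : ℂ) ≠ 0 := by
        exact_mod_cast pow_ne_zero 2 hx0
      have hxx' : ⟪x, x'⟫_ℂ = ((‖x'‖ ^ 2 : ℝ) : ℂ) := by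
        have e : x = α • v + x' := by simp [hx']
        rw [e, inner_add_left, inner_smul_left, vx', inner_self_eq_norm_sq_to_K]
        simp
      have hxw : ⟪x, w⟫_ℂ = 0 := by
        rw [hw, inner_add_right, inner_smul_right, hxv, hxx', hβ, div_mul_cancel₀ _ hx0']
        ring
      have hw2 : ‖w‖ ^ 2 * ‖x'‖ ^ 2 = ‖x‖ ^ 2 := by
        have := norm_add_sq_eq_norm_sq_add_norm_sq_of_inner_eq_zero v (β • x')
          (by rw [inner_smul_right, vx', mul_zero])
        rw [← hw, norm_smul, hv] at this
        have hb : ‖β‖ * ‖x'‖ ^ 2 = ‖α‖ := by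
          rw [hβ, norm_div, norm_neg, RCLike.norm_conj, Complex.norm_real, Real.norm_of_nonneg
            (by positivity), div_mul_cancel₀ _ (pow_ne_zero 2 hx0)]
        have : ‖w‖ ^ 2 * ‖x'‖ ^ 2 = ‖x'‖ ^ 2 + (‖β‖ * ‖x'‖ ^ 2) ^ 2 := by
          rw [pow_two ‖w‖, this]; ring
        rw [this, hb, hx2]; ring
      have hD : ‖D z‖ ^ 2 = ‖⟪v, z⟫_ℂ‖ ^ 2 * ‖x‖ ^ 2 + ‖⟪y', z⟫_ℂ‖ ^ 2 * ‖w‖ ^ 2 := by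
        have := norm_add_sq_eq_norm_sq_add_norm_sq_of_inner_eq_zero (⟪v, z⟫_ℂ • x) (⟪y', z⟫_ℂ • w)
          (by rw [inner_smul_left, inner_smul_right, hxw]; simp)
        rw [← Dap, norm_smul, norm_smul] at this
        rw [pow_two, this]; ring
      set z' : E := z - ⟪v, z⟫_ℂ • v with hz'
      have vz' : ⟪v, z'⟫_ℂ = 0 := by rw [hz', inner_sub_right, inner_smul_right, hvv]; ring
      have hz2 : ‖z‖ ^ 2 = ‖⟪v, z⟫_ℂ‖ ^ 2 + ‖z'‖ ^ 2 := by
        have e : z = ⟪v, z⟫_ℂ • v + z' := by simp [hz']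
        have := norm_add_sq_eq_norm_sq_add_norm_sq_of_inner_eq_zero (⟪v, z⟫_ℂ • v) z'
          (by rw [inner_smul_left, vz', mul_zero])
        rw [← e, norm_smul, hv] at this
        nlinarith
      have hyz : ⟪y', z⟫_ℂ = ⟪y', z'⟫_ℂ := by
        rw [hz', inner_sub_right, inner_smul_right, y'v]; simp
      have hyz2 : ‖⟪y', z⟫_ℂ‖ ^ 2 ≤ ‖x'‖ ^ 2 * ‖z'‖ ^ 2 := by
        have := pow_le_pow_left₀ (norm_nonneg _) (norm_inner_le_norm (𝕜 := ℂ) y' z') 2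
        rw [hyz]
        rw [mul_pow] at this
        exact this.trans (by gcongr)
      rw [hD, mul_pow, hz2]
      have := mul_le_mul_of_nonneg_right hyz2 (sq_nonneg ‖w‖)
      have e : ‖x'‖ ^ 2 * ‖z'‖ ^ 2 * ‖w‖ ^ 2 = ‖x‖ ^ 2 * ‖z'‖ ^ 2 := by rw [← hw2]; ring
      nlinarith

lemma completion (v x y : E) (hv : ‖v‖ = 1) (hxy : ⟪v, x⟫_ℂ = ⟪y, v⟫_ℂ) :
    ∃ D : E →L[ℂ] E, D v = x ∧ ContinuousLinearMap.adjoint D v = y ∧ ‖D‖ ≤ max ‖x‖ ‖y‖ := by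
  rcases le_total ‖y‖ ‖x‖ with h | h
  · obtain ⟨D, h1, h2, h3⟩ := completion_aux v x y hv hxy h
    exact ⟨D, h1, h2, h3.trans (le_max_left _ _)⟩
  · obtain ⟨D, h1, h2, h3⟩ := completion_aux v y x hv
      (by rw [← inner_conj_symm, ← hxy, inner_conj_symm]) h
    refine ⟨ContinuousLinearMap.adjoint D, h2, ?_, ?_⟩
    · rw [ContinuousLinearMap.adjoint_adjoint, h1]
    · rw [LinearIsometryEquiv.norm_map]
      exact h3.trans (le_max_right _ _)
end completion

lemma lamMin_le {n : ℕ} {M : Matrix (Fin n) (Fin n) ℂ} (hM : M.IsHermitian)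
    (v : EuclideanSpace ℂ (Fin n)) :
    lamMin M * ‖v‖ ^ 2 ≤ (⟪v, Matrix.toEuclideanCLM (𝕜 := ℂ) M v⟫_ℂ).re := by
  have key : ∀ i, ⟪hM.eigenvectorBasis i, Matrix.toEuclideanCLM (𝕜 := ℂ) M v⟫_ℂ
      = (hM.eigenvalues i : ℂ) * ⟪hM.eigenvectorBasis i, v⟫_ℂ := by
    intro i
    have e : Matrix.toEuclideanCLM (𝕜 := ℂ) M (hM.eigenvectorBasis i)
        = (hM.eigenvalues i : ℂ) • hM.eigenvectorBasis i := by
      ext j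
      have := congrFun (hM.mulVec_eigenvectorBasis i) j
      simpa using this
    have sa : ContinuousLinearMap.adjoint (Matrix.toEuclideanCLM (𝕜 := ℂ) M)
        = Matrix.toEuclideanCLM (𝕜 := ℂ) M := by
      rw [← ContinuousLinearMap.star_eq_adjoint, ← map_star]
      congr 1
    rw [← ContinuousLinearMap.adjoint_inner_left, sa, e, inner_smul_left]
    simp
  rw [← hM.eigenvectorBasis.sum_inner_mul_inner, ← hM.eigenvectorBasis.sum_sq_norm_inner_right v,
    Finset.mul_sum, Complex.re_sum]
  refine Finset.sum_le_sum fun i _ => ?_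
  rw [key]
  have : ⟪v, hM.eigenvectorBasis i⟫_ℂ * ((hM.eigenvalues i : ℂ) * ⟪hM.eigenvectorBasis i, v⟫_ℂ)
      = ((hM.eigenvalues i * ‖⟪hM.eigenvectorBasis i, v⟫_ℂ‖ ^ 2 : ℝ) : ℂ) := by
    rw [← inner_conj_symm v]
    push_cast
    rw [← Complex.conj_mul']
    ring
  rw [this, Complex.ofReal_re]
  gcongr
  rw [lamMin, dif_pos hM]
  exact ciInf_le (Set.finite_range _).bddBelow i

lemma exists_lamMin {n : ℕ} [NeZero n] {M : Matrix (Fin n) (Fin n) ℂ} (hM : M.IsHermitian) :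
    ∃ v : EuclideanSpace ℂ (Fin n), ‖v‖ = 1 ∧
      (⟪v, Matrix.toEuclideanCLM (𝕜 := ℂ) M v⟫_ℂ).re = lamMin M := by
  obtain ⟨i, hi⟩ := exists_eq_ciInf_of_finite (f := hM.eigenvalues)
  refine ⟨hM.eigenvectorBasis i, by simp, ?_⟩
  have e : Matrix.toEuclideanCLM (𝕜 := ℂ) M (hM.eigenvectorBasis i)
      = (hM.eigenvalues i : ℂ) • hM.eigenvectorBasis i := by
    ext j
    have := congrFun (hM.mulVec_eigenvectorBasis i) j
    simpa using this
  rw [e, inner_smul_right, inner_self_eq_norm_sq_to_K, lamMin, dif_pos hM, ← hi]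
  simp

/-- For a regular `*`-palindromic pencil `A + s Aᴴ`, the squared structured distance
to a common null space equals `2 · sup_{γ ∈ [0,1]} λ_min(AAᴴ + γ(AᴴA − AAᴴ))`. -/
theorem starPalindromic_distance_to_common_null_space
    {n : ℕ} (A : Matrix (Fin n) (Fin n) ℂ)
    (hreg : ∃ l : ℂ, (A + l • Aᴴ).det ≠ 0) :
    (sInf {r : ℝ | ∃ (D : Matrix (Fin n) (Fin n) ℂ) (v : Fin n → ℂ),
        v ≠ 0 ∧ (A - D).mulVec v = 0 ∧ (Aᴴ - Dᴴ).mulVec v = 0 ∧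
        r = Real.sqrt (specNorm D ^ 2 + specNorm Dᴴ ^ 2)}) ^ 2 =
      2 * ⨆ γ : Set.Icc (0 : ℝ) 1,
        lamMin (A * Aᴴ + (γ : ℝ) • (Aᴴ * A - A * Aᴴ)) := by
  rcases Nat.eq_zero_or_pos n with hn | hn
  · subst hn
    have h1 : {r : ℝ | ∃ (D : Matrix (Fin 0) (Fin 0) ℂ) (v : Fin 0 → ℂ),
        v ≠ 0 ∧ (A - D).mulVec v = 0 ∧ (Aᴴ - Dᴴ).mulVec v = 0 ∧
        r = Real.sqrt (specNorm D ^ 2 + specNorm Dᴴ ^ 2)} = ∅ := by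
      ext r
      simp only [Set.mem_ofPred_eq, Set.mem_empty_iff_false, iff_false]
      rintro ⟨D, v, hv, -⟩
      exact hv (Subsingleton.elim _ _)
    rw [h1]
    have h2 : ∀ M : Matrix (Fin 0) (Fin 0) ℂ, lamMin M = 0 := by
      intro M
      unfold lamMin
      split_ifs
      · exact Real.iInf_of_isEmpty _
      · rfl
    simp [h2]
  haveI : NeZero n := ⟨hn.ne'⟩
  let T := Matrix.toEuclideanCLM (n := Fin n) (𝕜 := ℂ)
  have Tadj : ∀ B, ContinuousLinearMap.adjoint (T B) = T Bᴴ := by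
    intro B
    rw [← ContinuousLinearMap.star_eq_adjoint, ← map_star]
    rfl
  have snorm : ∀ D, specNorm (k := Fin n) Dᴴ = specNorm D := by
    intro D
    change ‖T Dᴴ‖ = ‖T D‖
    rw [← Tadj, LinearIsometryEquiv.norm_map]
  let M : ℝ → Matrix (Fin n) (Fin n) ℂ := fun γ => A * Aᴴ + γ • (Aᴴ * A - A * Aᴴ)
  have hM : ∀ γ, (M γ).IsHermitian := by
    intro γ
    simp [M, Matrix.IsHermitian, Matrix.conjTranspose_add, Matrix.conjTranspose_smul,
      Matrix.conjTranspose_sub, Matrix.conjTranspose_mul]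
  have ray : ∀ γ v, (⟪v, T (M γ) v⟫_ℂ).re = (1 - γ) * ‖T Aᴴ v‖ ^ 2 + γ * ‖T A v‖ ^ 2 := by
    intro γ v
    have q : ∀ B, ⟪v, T (Bᴴ * B) v⟫_ℂ = ((‖T B v‖ ^ 2 : ℝ) : ℂ) := by
      intro B
      rw [map_mul, ← Tadj, ContinuousLinearMap.mul_apply, ContinuousLinearMap.adjoint_inner_right,
        inner_self_eq_norm_sq_to_K]
      simp
    have q1 := q A
    have q2 := q Aᴴ
    rw [Matrix.conjTranspose_conjTranspose] at q2
    have e : M γ = A * Aᴴ + (γ : ℂ) • (Aᴴ * A - A * Aᴴ) := by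
      ext i j
      simp [M]
    rw [e, map_add, map_smul, map_sub]
    simp only [ContinuousLinearMap.add_apply, ContinuousLinearMap.smul_apply,
      ContinuousLinearMap.sub_apply, inner_add_right, inner_smul_right, inner_sub_right, q1, q2]
    rw [← Complex.ofReal_sub, ← Complex.ofReal_mul, ← Complex.ofReal_add, Complex.ofReal_re]
    ring
  change _ = 2 * ⨆ γ : Set.Icc (0 : ℝ) 1, lamMin (M γ)
  have bound : ∀ (v : EuclideanSpace ℂ (Fin n)) (c : ℝ), v ≠ 0 → ‖T A v‖ ^ 2 ≤ c * ‖v‖ ^ 2 →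
      ‖T Aᴴ v‖ ^ 2 ≤ c * ‖v‖ ^ 2 → ∀ γ : Set.Icc (0 : ℝ) 1, lamMin (M γ) ≤ c := by
    intro v c hv h1 h2 γ
    have := lamMin_le (hM γ) v
    have r := ray γ v
    simp only [T] at r h1 h2
    rw [r] at this
    have hv2 : 0 < ‖v‖ ^ 2 := by positivity
    refine le_of_mul_le_mul_right (this.trans ?_) hv2
    have a1 := mul_le_mul_of_nonneg_left h1 γ.2.1
    have a2 := mul_le_mul_of_nonneg_left h2 (sub_nonneg.mpr γ.2.2)
    linarith
  set t := ⨆ γ : Set.Icc (0 : ℝ) 1, lamMin (M γ) with ht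
  have bdd : BddAbove (Set.range fun γ : Set.Icc (0 : ℝ) 1 => lamMin (M γ)) := by
    obtain ⟨v, hv, -⟩ := exists_lamMin (hM 0)
    refine ⟨max (‖T A v‖ ^ 2) (‖T Aᴴ v‖ ^ 2), ?_⟩
    rintro _ ⟨γ, rfl⟩
    refine bound v _ ?_ ?_ ?_ γ
    · rintro rfl; simp at hv
    · rw [hv]; simp
    · rw [hv]; simp
  -- the expansion of the quadratic forms
  have expand : ∀ B (a b : ℝ) (x y : EuclideanSpace ℂ (Fin n)),
      ‖T B (a • x + b • y)‖ ^ 2 - t * ‖a • x + b • y‖ ^ 2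
      = a ^ 2 * (‖T B x‖ ^ 2 - t * ‖x‖ ^ 2) + b ^ 2 * (‖T B y‖ ^ 2 - t * ‖y‖ ^ 2)
        + a * b * (2 * (⟪T B x, T B y⟫_ℂ).re - t * (2 * (⟪x, y⟫_ℂ).re)) := by
    intro B a b x y
    have q : ∀ x y : EuclideanSpace ℂ (Fin n), ‖a • x + b • y‖ ^ 2 =
        a ^ 2 * ‖x‖ ^ 2 + b ^ 2 * ‖y‖ ^ 2 + a * b * (2 * (⟪x, y⟫_ℂ).re) := by
      intro x y
      rw [norm_add_sq (𝕜 := ℂ), norm_smul, norm_smul, mul_pow, mul_pow, Real.norm_eq_abs,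
        Real.norm_eq_abs, sq_abs, sq_abs, ← Complex.coe_smul, ← Complex.coe_smul, inner_smul_left,
        inner_smul_right]
      simp
      ring
    have e : T B (a • x + b • y) = a • T B x + b • T B y := by
      rw [map_add, ← Complex.coe_smul, ← Complex.coe_smul, map_smul, map_smul,
        Complex.coe_smul, Complex.coe_smul]
    rw [e, q, q]
    ring
  obtain ⟨v₀, hv₀, hp₀, hq₀⟩ := quad_common
    (fun v => ‖T Aᴴ v‖ ^ 2 - t * ‖v‖ ^ 2) (fun v => ‖T A v‖ ^ 2 - t * ‖v‖ ^ 2) _ _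
    (by fun_prop) (by fun_prop) (expand Aᴴ) (expand A)
    (by
      intro γ hγ
      obtain ⟨v, hv, hl⟩ := exists_lamMin (hM γ)
      refine ⟨v, hv, ?_⟩
      have r := ray γ v
      simp only [T] at r ⊢
      rw [hl] at r
      have : lamMin (M γ) ≤ t := le_ciSup bdd (⟨γ, hγ⟩ : Set.Icc (0 : ℝ) 1)
      rw [hv]
      linarith)
  -- normalise
  obtain ⟨v, hv, hp, hq⟩ : ∃ v : EuclideanSpace ℂ (Fin n), ‖v‖ = 1 ∧ ‖T Aᴴ v‖ ^ 2 ≤ t ∧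
      ‖T A v‖ ^ 2 ≤ t := by
    have hn0 : ‖v₀‖ ≠ 0 := norm_ne_zero_iff.mpr hv₀
    have sc : ∀ B, ‖T B v₀‖ ^ 2 - t * ‖v₀‖ ^ 2 ≤ 0 →
        ‖T B (((‖v₀‖⁻¹ : ℝ) : ℂ) • v₀)‖ ^ 2 ≤ t := by
      intro B hB
      rw [map_smul, norm_smul, Complex.norm_real, norm_inv, norm_norm, mul_pow, inv_pow,
        inv_mul_le_iff₀ (by positivity)]
      linarith
    refine ⟨((‖v₀‖⁻¹ : ℝ) : ℂ) • v₀, ?_, sc _ hp₀, sc _ hq₀⟩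
    rw [norm_smul, Complex.norm_real, norm_inv, norm_norm, inv_mul_cancel₀ hn0]
  have t0 : 0 ≤ t := (sq_nonneg _).trans hp
  have main : IsLeast {r : ℝ | ∃ (D : Matrix (Fin n) (Fin n) ℂ) (v : Fin n → ℂ),
        v ≠ 0 ∧ (A - D).mulVec v = 0 ∧ (Aᴴ - Dᴴ).mulVec v = 0 ∧
        r = Real.sqrt (specNorm D ^ 2 + specNorm Dᴴ ^ 2)} (Real.sqrt (2 * t)) := by
    have lower : ∀ r ∈ {r : ℝ | ∃ (D : Matrix (Fin n) (Fin n) ℂ) (v : Fin n → ℂ),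
        v ≠ 0 ∧ (A - D).mulVec v = 0 ∧ (Aᴴ - Dᴴ).mulVec v = 0 ∧
        r = Real.sqrt (specNorm D ^ 2 + specNorm Dᴴ ^ 2)}, Real.sqrt (2 * t) ≤ r := by
      rintro r ⟨D, w, hw, h1, h2, rfl⟩
      rw [snorm, ← two_mul]
      apply Real.sqrt_le_sqrt
      gcongr
      refine ciSup_le fun γ => bound (WithLp.toLp 2 w) _ ?_ ?_ ?_ γ
      · simpa using hw
      · have e : T A (WithLp.toLp 2 w) = T D (WithLp.toLp 2 w) := by
          rw [Matrix.sub_mulVec, sub_eq_zero] at h1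
          simp [T, h1]
        rw [e, ← mul_pow]
        gcongr
        exact (T D).le_opNorm _
      · have e : T Aᴴ (WithLp.toLp 2 w) = T Dᴴ (WithLp.toLp 2 w) := by
          rw [Matrix.sub_mulVec, sub_eq_zero] at h2
          simp [T, h2]
        rw [e, ← mul_pow, ← snorm]
        gcongr
        exact (T Dᴴ).le_opNorm _
    refine ⟨?_, lower⟩
    obtain ⟨D', hD1, hD2, hD3⟩ := completion v (T A v) (T Aᴴ v) hv
      (by rw [← Tadj, ContinuousLinearMap.adjoint_inner_left])
    obtain ⟨D, rfl⟩ : ∃ D, T D = D' := T.surjective D'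
    rw [Tadj] at hD2
    have hD4 : specNorm D ^ 2 ≤ t := by
      have : specNorm D ≤ max ‖T A v‖ ‖T Aᴴ v‖ := hD3
      have h0 : 0 ≤ specNorm D := norm_nonneg _
      rcases le_total ‖T A v‖ ‖T Aᴴ v‖ with h | h
      · rw [max_eq_right h] at this
        exact (pow_le_pow_left₀ h0 this 2).trans hp
      · rw [max_eq_left h] at this
        exact (pow_le_pow_left₀ h0 this 2).trans hq
    have mem : Real.sqrt (specNorm D ^ 2 + specNorm Dᴴ ^ 2) ∈
        {r : ℝ | ∃ (D : Matrix (Fin n) (Fin n) ℂ) (v : Fin n → ℂ),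
        v ≠ 0 ∧ (A - D).mulVec v = 0 ∧ (Aᴴ - Dᴴ).mulVec v = 0 ∧
        r = Real.sqrt (specNorm D ^ 2 + specNorm Dᴴ ^ 2)} := by
      refine ⟨D, WithLp.ofLp v, ?_, ?_, ?_, rfl⟩
      · intro h
        have : v = 0 := by
          ext i
          exact congrFun h i
        rw [this] at hv
        simp at hv
      · rw [Matrix.sub_mulVec, sub_eq_zero]
        have := congrArg WithLp.ofLp hD1
        simpa [T] using this.symm
      · rw [Matrix.sub_mulVec, sub_eq_zero]
        have := congrArg WithLp.ofLp hD2
        simpa [T] using this.symm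
    have : Real.sqrt (2 * t) = Real.sqrt (specNorm D ^ 2 + specNorm Dᴴ ^ 2) := by
      refine le_antisymm (lower _ mem) ?_
      rw [snorm]
      apply Real.sqrt_le_sqrt
      linarith
    rw [this]
    exact mem
  rw [main.csInf_eq, Real.sq_sqrt (by positivity)]
end

section
/- Let A ∈ ℂ^{n×n} be such that the T-palindromic pencil L(s) = A + sAᵀ is regular. Then the square of the structured distance to a common null space satisfies δ₀^{palT}(A,Aᵀ)² = 2 · sup_{γ ∈ [0,1]} λ_min( Ā·Aᵀ + γ(AᴴA − Ā·Aᵀ) ), where Ā denotes the entrywise complex conjugate of A, and δ₀^{palT}(A,Aᵀ) is the infimum of √(‖Δ‖² + ‖Δᵀ‖²) over all Δ ∈ ℂ^{n×n} for which there exists a nonzero v ∈ ℂⁿ with (A − Δ)v = 0 and (Aᵀ − Δᵀ)v = 0. -/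
open Matrix

section helpers

open scoped InnerProductSpace ComplexConjugate ComplexOrder

lemma aux_yuan {V : Type*} [AddCommGroup V] [Module ℝ V] (F G : V → ℝ) (bF bG : V → V → ℝ)
    (hF : ∀ v w (a b : ℝ), F (a • v + b • w) = a ^ 2 * F v + b ^ 2 * F w + a * b * bF v w)
    (hG : ∀ v w (a b : ℝ), G (a • v + b • w) = a ^ 2 * G v + b ^ 2 * G w + a * b * bG v w)
    (h : ∀ v, 0 ≤ F v ∨ 0 ≤ G v) :
    ∃ γ ∈ Set.Icc (0 : ℝ) 1, ∀ v, 0 ≤ γ * F v + (1 - γ) * G v := by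
  by_contra hcon
  push Not at hcon
  let U : Set ℝ := {γ | ∃ v, γ * F v + (1 - γ) * G v < 0 ∧ 0 ≤ F v}
  let W : Set ℝ := {γ | ∃ v, γ * F v + (1 - γ) * G v < 0 ∧ 0 ≤ G v}
  have hop : ∀ (K : V → ℝ), IsOpen {γ : ℝ | ∃ v, γ * F v + (1 - γ) * G v < 0 ∧ 0 ≤ K v} := by
    intro K
    have : {γ : ℝ | ∃ v, γ * F v + (1 - γ) * G v < 0 ∧ 0 ≤ K v} =
        ⋃ v ∈ {v | 0 ≤ K v}, {γ : ℝ | γ * F v + (1 - γ) * G v < 0} := by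
      ext γ; simp; tauto
    rw [this]
    refine isOpen_biUnion fun v _ => isOpen_lt (by fun_prop) (by fun_prop)
  have hU : IsOpen U := hop F
  have hW : IsOpen W := hop G
  have hcov : Set.Icc (0 : ℝ) 1 ⊆ U ∪ W := by
    intro γ hγ
    obtain ⟨v, hv⟩ := hcon γ hγ
    rcases h v with h1 | h1
    · exact Or.inl ⟨v, hv, h1⟩
    · exact Or.inr ⟨v, hv, h1⟩
  have h0 : (Set.Icc (0 : ℝ) 1 ∩ U).Nonempty := by
    refine ⟨0, by simp, ?_⟩
    obtain ⟨v, hv⟩ := hcon 0 (by simp)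
    refine ⟨v, hv, ?_⟩
    rcases h v with h1 | h1
    · exact h1
    · linarith
  have h1 : (Set.Icc (0 : ℝ) 1 ∩ W).Nonempty := by
    refine ⟨1, by simp, ?_⟩
    obtain ⟨v, hv⟩ := hcon 1 (by simp)
    refine ⟨v, hv, ?_⟩
    rcases h v with h1 | h1
    · linarith
    · exact h1
  obtain ⟨γ, ⟨hγ0, hγ1⟩, ⟨v, hv, hFv⟩, ⟨w, hw, hGw⟩⟩ :=
    isPreconnected_Icc U W hU hW hcov h0 h1
  have hGv : G v < 0 := by
    by_contra hh
    push Not at hh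
    nlinarith [mul_nonneg hγ0 hFv, mul_nonneg (sub_nonneg.2 hγ1) hh]
  have hFw : F w < 0 := by
    by_contra hh
    push Not at hh
    nlinarith [mul_nonneg hγ0 hh, mul_nonneg (sub_nonneg.2 hγ1) hGw]
  obtain ⟨e, he, hce⟩ : ∃ e : ℝ, e ^ 2 = 1 ∧ e * (γ * bF v w + (1 - γ) * bG v w) ≤ 0 := by
    rcases le_total (γ * bF v w + (1 - γ) * bG v w) 0 with hc | hc
    · exact ⟨1, by norm_num, by linarith⟩
    · exact ⟨-1, by norm_num, by linarith⟩
  have hivt := intermediate_value_Icc' (f := fun t : ℝ =>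
    (1 - t) ^ 2 * (F v - G v) + t ^ 2 * (F w - G w) + (1 - t) * t * (e * (bF v w - bG v w)))
    (zero_le_one' ℝ) (by fun_prop)
  obtain ⟨t, ⟨ht0, ht1⟩, ht⟩ := hivt (show (0 : ℝ) ∈ _ by constructor <;> norm_num <;> linarith)
  simp only at ht
  have hFz := hF v w (1 - t) (t * e)
  have hGz := hG v w (1 - t) (t * e)
  have ht' : t * (1 - t) ≥ 0 := mul_nonneg ht0 (by linarith)
  rw [mul_pow, he] at hFz hGz
  have hP : γ * F ((1 - t) • v + (t * e) • w) + (1 - γ) * G ((1 - t) • v + (t * e) • w) < 0 := by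
    rw [hFz, hGz]
    have e1 : (1 - t) ^ 2 * (γ * F v + (1 - γ) * G v) + t ^ 2 * (γ * F w + (1 - γ) * G w) < 0 := by
      rcases eq_or_lt_of_le ht0 with rfl | ht0
      · nlinarith
      · have := mul_neg_of_pos_of_neg (pow_pos ht0 2) hw
        have := mul_nonpos_of_nonneg_of_nonpos (sq_nonneg (1 - t)) hv.le
        linarith
    have e2 := mul_nonpos_of_nonneg_of_nonpos ht' hce
    linarith
  have hEq : F ((1 - t) • v + (t * e) • w) = G ((1 - t) • v + (t * e) • w) := by
    rw [hFz, hGz]; linarith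
  rcases h ((1 - t) • v + (t * e) • w) with h1 | h1
  · rw [← hEq] at hP; linarith
  · rw [hEq] at hP; linarith

lemma aux_normsq {E : Type*} [NormedAddCommGroup E] [InnerProductSpace ℂ E] (x y : E) (a b : ℝ) :
    ‖(a : ℂ) • x + (b : ℂ) • y‖ ^ 2 =
      a ^ 2 * ‖x‖ ^ 2 + b ^ 2 * ‖y‖ ^ 2 + a * b * (2 * (⟪x, y⟫_ℂ).re) := by
  rw [@norm_add_sq ℂ, norm_smul, norm_smul, inner_smul_left, inner_smul_right]
  simp [mul_pow]
  ring

lemma aux_minimax {E : Type*} [NormedAddCommGroup E] [InnerProductSpace ℂ E] (S T : E →L[ℂ] E)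
    (m : ℝ) (h : ∀ v, ‖v‖ = 1 → m ≤ max (‖T v‖ ^ 2) (‖S v‖ ^ 2)) :
    ∃ γ ∈ Set.Icc (0 : ℝ) 1, ∀ v, m * ‖v‖ ^ 2 ≤ γ * ‖T v‖ ^ 2 + (1 - γ) * ‖S v‖ ^ 2 := by
  have key : ∀ R : E →L[ℂ] E, ∀ v w (a b : ℝ),
      ‖R ((a : ℂ) • v + (b : ℂ) • w)‖ ^ 2 - m * ‖(a : ℂ) • v + (b : ℂ) • w‖ ^ 2 =
      a ^ 2 * (‖R v‖ ^ 2 - m * ‖v‖ ^ 2) + b ^ 2 * (‖R w‖ ^ 2 - m * ‖w‖ ^ 2) +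
      a * b * (2 * (⟪R v, R w⟫_ℂ).re - m * (2 * (⟪v, w⟫_ℂ).re)) := by
    intro R v w a b
    rw [map_add, map_smul, map_smul, aux_normsq, aux_normsq]; ring
  obtain ⟨γ, hγ, hh⟩ := aux_yuan (V := E) (fun v => ‖T v‖ ^ 2 - m * ‖v‖ ^ 2)
    (fun v => ‖S v‖ ^ 2 - m * ‖v‖ ^ 2)
    (fun v w => 2 * (⟪T v, T w⟫_ℂ).re - m * (2 * (⟪v, w⟫_ℂ).re))
    (fun v w => 2 * (⟪S v, S w⟫_ℂ).re - m * (2 * (⟪v, w⟫_ℂ).re))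
    (fun v w a b => key T v w a b) (fun v w a b => key S v w a b) (by
      intro v
      rcases eq_or_ne v 0 with rfl | hv
      · left; simp
      have hv0 : ‖v‖ ≠ 0 := norm_ne_zero_iff.2 hv
      have hpos : 0 < ‖v‖ ^ 2 := by positivity
      have h1 := h (((‖v‖⁻¹ : ℝ) : ℂ) • v) (by rw [norm_smul]; simp [hv0])
      rw [map_smul, map_smul, norm_smul, norm_smul] at h1
      simp only [Complex.norm_real, norm_inv, norm_norm, mul_pow, inv_pow] at h1
      rcases le_max_iff.1 h1 with h2 | h2
      · left
        rw [inv_mul_eq_div, le_div_iff₀ hpos] at h2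
        linarith
      · right
        rw [inv_mul_eq_div, le_div_iff₀ hpos] at h2
        linarith)
  exact ⟨γ, hγ, fun v => by have := hh v; linarith⟩

lemma aux_scalar (s α β : ℂ) (d : ℝ) (hd : 0 < d) :
    ‖α * s + β‖ ^ 2 + d * ‖s - conj α / d * β‖ ^ 2 =
      (d + ‖α‖ ^ 2) * (‖s‖ ^ 2 + ‖β‖ ^ 2 / d) := by
  have : conj α / (d : ℂ) * β = ((d⁻¹ : ℝ) : ℂ) * (conj α * β) := by
    push_cast; field_simp
  rw [this]
  simp only [← Complex.normSq_eq_norm_sq, Complex.normSq_apply, Complex.add_re, Complex.add_im,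
    Complex.sub_re, Complex.sub_im, Complex.mul_re, Complex.mul_im, Complex.conj_re,
    Complex.conj_im, Complex.ofReal_re, Complex.ofReal_im]
  field_simp
  ring

lemma aux_dkw {E : Type*} [NormedAddCommGroup E] [InnerProductSpace ℂ E] (u v x y : E)
    (hu : ‖u‖ = 1) (hv : ‖v‖ = 1) (hc : ⟪u, x⟫_ℂ = ⟪y, v⟫_ℂ) :
    ∃ D : E →L[ℂ] E, D v = x ∧ (∀ w, ⟪u, D w⟫_ℂ = ⟪y, w⟫_ℂ) ∧
      ‖D‖ ^ 2 ≤ max (‖x‖ ^ 2) (‖y‖ ^ 2) := by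
  set α := ⟪u, x⟫_ℂ with hα
  set μ := max (‖x‖ ^ 2) (‖y‖ ^ 2) with hμ
  set d : ℝ := μ - ‖α‖ ^ 2 with hd
  have huu : ⟪u, u⟫_ℂ = 1 := by rw [inner_self_eq_norm_sq_to_K, hu]; simp
  have hvv : ⟪v, v⟫_ℂ = 1 := by rw [inner_self_eq_norm_sq_to_K, hv]; simp
  have hvu : ⟪v, y⟫_ℂ = conj α := by rw [hc, inner_conj_symm]
  set c : E := x - α • u with hcdef
  set b : E := y - conj α • v with hbdef
  have huc : ⟪u, c⟫_ℂ = 0 := by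
    rw [hcdef, inner_sub_right, inner_smul_right, huu, ← hα]; ring
  have hvb : ⟪v, b⟫_ℂ = 0 := by
    rw [hbdef, inner_sub_right, inner_smul_right, hvv, hvu]; ring
  have pyth : ∀ (a a' : ℂ) (e f : E), ‖e‖ = 1 → ⟪e, f⟫_ℂ = 0 →
      ‖a • e + a' • f‖ ^ 2 = ‖a‖ ^ 2 + ‖a'‖ ^ 2 * ‖f‖ ^ 2 := by
    intro a a' e f he hf
    rw [@norm_add_sq ℂ, inner_smul_left, inner_smul_right, hf, norm_smul, norm_smul, he]
    simp [mul_pow]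
  have hx : ‖x‖ ^ 2 = ‖α‖ ^ 2 + ‖c‖ ^ 2 := by
    have := pyth α 1 u c hu huc
    rw [one_smul, hcdef, add_sub_cancel] at this
    simpa using this
  have hy : ‖y‖ ^ 2 = ‖α‖ ^ 2 + ‖b‖ ^ 2 := by
    have := pyth (conj α) 1 v b hv hvb
    rw [one_smul, hbdef, add_sub_cancel] at this
    simpa using this
  have hcd : ‖c‖ ^ 2 ≤ d := by have := le_max_left (‖x‖ ^ 2) (‖y‖ ^ 2); linarith
  have hbd : ‖b‖ ^ 2 ≤ d := by have := le_max_right (‖x‖ ^ 2) (‖y‖ ^ 2); linarith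
  let D : E →L[ℂ] E := (innerSL ℂ y).smulRight u +
    (innerSL ℂ v - (conj α / (d : ℂ)) • (innerSL ℂ b)).smulRight c
  have hD : ∀ w, D w = ⟪y, w⟫_ℂ • u + (⟪v, w⟫_ℂ - conj α / (d : ℂ) * ⟪b, w⟫_ℂ) • c := by
    intro w; simp [D]
  refine ⟨D, ?_, ?_, ?_⟩
  · rw [hD, hvv, ← hc, ← inner_conj_symm b v, hvb]
    simp [hcdef]
  · intro w
    rw [hD, inner_add_right, inner_smul_right, inner_smul_right, huu, huc]; ring
  · have hμ0 : 0 ≤ μ := le_trans (sq_nonneg _) (le_max_left _ _)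
    have : ‖D‖ ≤ √μ := by
      refine ContinuousLinearMap.opNorm_le_bound _ (Real.sqrt_nonneg _) fun w => ?_
      refine (sq_le_sq₀ (by positivity) (by positivity)).1 ?_
      rw [mul_pow, Real.sq_sqrt hμ0, hD, pyth _ _ _ _ hu huc]
      set s := ⟪v, w⟫_ℂ with hs
      set β := ⟪b, w⟫_ℂ with hβ
      have hyw : ⟪y, w⟫_ℂ = α * s + β := by
        rw [hβ, hbdef, inner_sub_left, inner_smul_left, ← hs]; simp
      set p : E := w - s • v with hp
      have hvp : ⟪v, p⟫_ℂ = 0 := by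
        rw [hp, inner_sub_right, inner_smul_right, hvv, ← hs]; ring
      have hw : ‖w‖ ^ 2 = ‖s‖ ^ 2 + ‖p‖ ^ 2 := by
        have := pyth s 1 v p hv hvp
        rw [one_smul, hp, add_sub_cancel] at this
        simpa using this
      have hbp : ⟪b, p⟫_ℂ = β := by
        rw [hp, inner_sub_right, inner_smul_right, ← inner_conj_symm b v, hvb, ← hβ]; simp
      have hβle : ‖β‖ ^ 2 ≤ d * ‖p‖ ^ 2 := by
        have h1 : ‖β‖ ≤ ‖b‖ * ‖p‖ := by rw [← hbp]; exact norm_inner_le_norm _ _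
        calc ‖β‖ ^ 2 ≤ (‖b‖ * ‖p‖) ^ 2 := by gcongr
          _ = ‖b‖ ^ 2 * ‖p‖ ^ 2 := by ring
          _ ≤ _ := by gcongr
      rw [hyw, hw]
      have hd0 : 0 ≤ d := le_trans (sq_nonneg _) hcd
      rcases eq_or_lt_of_le hd0 with hd0 | hd0
      · have hβ0 : β = 0 := by
          rw [← hd0] at hβle
          simpa using hβle
        have hc0 : ‖c‖ ^ 2 = 0 := le_antisymm (hd0 ▸ hcd) (sq_nonneg _)
        rw [hβ0, hc0]
        have : μ = ‖α‖ ^ 2 := by linarith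
        rw [this]
        simp [mul_pow]
        nlinarith [mul_nonneg (sq_nonneg ‖α‖) (sq_nonneg ‖p‖)]
      · have h1 := aux_scalar s α β d hd0
        have h2 : d + ‖α‖ ^ 2 = μ := by linarith
        rw [h2] at h1
        have h3 : ‖β‖ ^ 2 / d ≤ ‖p‖ ^ 2 := by
          rw [div_le_iff₀ hd0]; linarith
        calc _ ≤ ‖α * s + β‖ ^ 2 + d * ‖s - conj α / d * β‖ ^ 2 := by
              rw [mul_comm d]; gcongr
          _ = _ := h1
          _ ≤ _ := by gcongr
    calc ‖D‖ ^ 2 ≤ (√μ) ^ 2 := by gcongr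
      _ = μ := Real.sq_sqrt hμ0

variable {n : ℕ}

lemma aux_clm_apply (A : Matrix (Fin n) (Fin n) ℂ) (v : EuclideanSpace ℂ (Fin n)) :
    Matrix.toEuclideanCLM (𝕜 := ℂ) A v = WithLp.toLp 2 (A *ᵥ v.ofLp) := by
  apply (WithLp.ofLp_injective 2)
  simp

lemma aux_normsq_dot (w : Fin n → ℂ) :
    ‖(WithLp.toLp 2 w : EuclideanSpace ℂ (Fin n))‖ ^ 2 = (star w ⬝ᵥ w).re := by
  rw [EuclideanSpace.norm_sq_eq]
  simp [dotProduct, ← Complex.normSq_eq_norm_sq, Complex.normSq_apply]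

lemma aux_norm_star (w : Fin n → ℂ) :
    ‖(WithLp.toLp 2 (star w) : EuclideanSpace ℂ (Fin n))‖ =
      ‖(WithLp.toLp 2 w : EuclideanSpace ℂ (Fin n))‖ := by
  simp [EuclideanSpace.norm_eq]

lemma aux_quad (A : Matrix (Fin n) (Fin n) ℂ) (v : EuclideanSpace ℂ (Fin n)) :
    (star v.ofLp ⬝ᵥ ((Aᴴ * A) *ᵥ v.ofLp)).re = ‖Matrix.toEuclideanCLM (𝕜 := ℂ) A v‖ ^ 2 := by
  rw [aux_clm_apply, aux_normsq_dot, ← Matrix.mulVec_mulVec, Matrix.dotProduct_mulVec,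
    Matrix.star_mulVec]

lemma aux_specNorm_transpose_le (D : Matrix (Fin n) (Fin n) ℂ) : specNorm Dᵀ ≤ specNorm D := by
  have h1 : specNorm Dᴴ = specNorm D := by
    unfold specNorm
    rw [← Matrix.star_eq_conjTranspose, map_star]
    exact ContinuousLinearMap.adjoint.norm_map _
  rw [← h1]
  unfold specNorm
  refine ContinuousLinearMap.opNorm_le_bound _ (norm_nonneg _) fun w => ?_
  have h2 := (Matrix.toEuclideanCLM (𝕜 := ℂ) Dᴴ).le_opNorm (WithLp.toLp 2 (star w.ofLp))
  rw [aux_norm_star, aux_clm_apply Dᴴ] at h2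
  rw [aux_clm_apply]
  have h3 : Dᴴ *ᵥ star w.ofLp = star (Dᵀ *ᵥ w.ofLp) := by
    rw [Matrix.star_mulVec]
    ext i
    simp [Matrix.mulVec, Matrix.vecMul, dotProduct, mul_comm]
  simp only [h3] at h2
  rw [aux_norm_star] at h2
  exact h2

lemma aux_specNorm_transpose (D : Matrix (Fin n) (Fin n) ℂ) : specNorm Dᵀ = specNorm D :=
  le_antisymm (aux_specNorm_transpose_le D) (by
    simpa using aux_specNorm_transpose_le Dᵀ)

lemma aux_le_lamMin [NeZero n] (H : Matrix (Fin n) (Fin n) ℂ) (hH : H.IsHermitian) (m : ℝ)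
    (h : ∀ v : EuclideanSpace ℂ (Fin n),
      m * ‖v‖ ^ 2 ≤ (star v.ofLp ⬝ᵥ (H *ᵥ v.ofLp)).re) : m ≤ lamMin H := by
  unfold lamMin
  rw [dif_pos hH]
  refine le_ciInf fun i => ?_
  have := h (hH.eigenvectorBasis i)
  rw [hH.eigenvectorBasis.norm_eq_one] at this
  rw [hH.eigenvalues_eq]
  simpa using this

lemma aux_lamMin_le (H : Matrix (Fin n) (Fin n) ℂ) (hH : H.IsHermitian)
    (v : EuclideanSpace ℂ (Fin n)) :
    lamMin H * ‖v‖ ^ 2 ≤ (star v.ofLp ⬝ᵥ (H *ᵥ v.ofLp)).re := by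
  set c := lamMin H with hc
  have hle : ∀ i, c ≤ hH.eigenvalues i := by
    intro i
    rw [hc]; unfold lamMin; rw [dif_pos hH]
    exact ciInf_le (Set.finite_range _).bddBelow i
  have hH' : (H - (c : ℂ) • (1 : Matrix (Fin n) (Fin n) ℂ)).IsHermitian := by
    refine hH.sub ?_
    unfold Matrix.IsHermitian
    simp
  have hpsd : (H - (c : ℂ) • (1 : Matrix (Fin n) (Fin n) ℂ)).PosSemidef := by
    rw [hH'.posSemidef_iff_eigenvalues_nonneg]
    intro i
    have h1 := hH'.mulVec_eigenvectorBasis i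
    set e := hH'.eigenvectorBasis i with he
    have hne : e.ofLp ≠ 0 := by
      intro h0
      have := hH'.eigenvectorBasis.norm_eq_one i
      rw [← he] at this
      have h00 : e = 0 := by ext j; simp [h0]
      rw [h00] at this
      simp at this
    have h2 : H *ᵥ e.ofLp = ((hH'.eigenvalues i + c : ℝ) : ℂ) • e.ofLp := by
      rw [Matrix.sub_mulVec, Matrix.smul_mulVec, Matrix.one_mulVec, sub_eq_iff_eq_add] at h1
      rw [h1]
      ext j; simp; ring
    have h3 : (hH'.eigenvalues i + c) ∈ spectrum ℝ H := by
      rw [spectrum.mem_iff]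
      intro hu
      rw [Matrix.isUnit_iff_isUnit_det, isUnit_iff_ne_zero] at hu
      apply hu
      apply Matrix.exists_mulVec_eq_zero_iff.1
      refine ⟨e.ofLp, hne, ?_⟩
      rw [Matrix.sub_mulVec, h2, Algebra.algebraMap_eq_smul_one, Matrix.smul_mulVec,
        Matrix.one_mulVec]
      ext j; simp
    rw [hH.spectrum_real_eq_range_eigenvalues] at h3
    obtain ⟨j, hj⟩ := h3
    have := hle j
    simp only [Pi.zero_apply]
    linarith
  have h4 := hpsd.dotProduct_mulVec_nonneg v.ofLp
  have h5 := (Complex.le_def.1 h4).1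
  rw [Matrix.sub_mulVec, Matrix.smul_mulVec, Matrix.one_mulVec, dotProduct_sub,
    dotProduct_smul] at h5
  have h6 := aux_normsq_dot v.ofLp
  rw [WithLp.toLp_ofLp] at h6
  rw [h6]
  simp at h5
  exact h5

end helpers

/-- For a regular `T`-palindromic pencil `A + s Aᵀ`, the squared structured distance
to a common null space equals `2 · sup_{γ ∈ [0,1]} λ_min(Ā·Aᵀ + γ(AᴴA − Ā·Aᵀ))`,
where `Ā = Aᴴᵀ` is the entrywise conjugate of `A`. -/
theorem TPalindromic_distance_to_common_null_space
    {n : ℕ} (A : Matrix (Fin n) (Fin n) ℂ)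
    (hreg : ∃ l : ℂ, (A + l • Aᵀ).det ≠ 0) :
    (sInf {r : ℝ | ∃ (D : Matrix (Fin n) (Fin n) ℂ) (v : Fin n → ℂ),
        v ≠ 0 ∧ (A - D).mulVec v = 0 ∧ (Aᵀ - Dᵀ).mulVec v = 0 ∧
        r = Real.sqrt (specNorm D ^ 2 + specNorm Dᵀ ^ 2)}) ^ 2 =
      2 * ⨆ γ : Set.Icc (0 : ℝ) 1,
        lamMin (Aᴴᵀ * Aᵀ + (γ : ℝ) • (Aᴴ * A - Aᴴᵀ * Aᵀ)) := by
  have htt : Aᴴᵀ = Aᵀᴴ := rfl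
  set δ := sInf {r : ℝ | ∃ (D : Matrix (Fin n) (Fin n) ℂ) (v : Fin n → ℂ),
        v ≠ 0 ∧ (A - D).mulVec v = 0 ∧ (Aᵀ - Dᵀ).mulVec v = 0 ∧
        r = Real.sqrt (specNorm D ^ 2 + specNorm Dᵀ ^ 2)} with hδ
  rcases Nat.eq_zero_or_pos n with rfl | hn
  · have h1 : δ = 0 := by
      rw [hδ]
      convert Real.sInf_empty
      ext r
      simp only [Set.mem_ofPred_eq, Set.mem_empty_iff_false, iff_false]
      rintro ⟨D, v, hv, -⟩
      exact hv (Subsingleton.elim _ _)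
    have h2 : ∀ H : Matrix (Fin 0) (Fin 0) ℂ, lamMin H = 0 := by
      intro H
      unfold lamMin
      split_ifs
      · exact Real.iInf_of_isEmpty _
      · rfl
    simp [h1, h2]
  have : NeZero n := ⟨hn.ne'⟩
  set T := Matrix.toEuclideanCLM (𝕜 := ℂ) A with hT
  set S := Matrix.toEuclideanCLM (𝕜 := ℂ) Aᵀ with hS
  have hherm : ∀ γ : ℝ, (Aᴴᵀ * Aᵀ + γ • (Aᴴ * A - Aᴴᵀ * Aᵀ)).IsHermitian := by
    intro γ
    have e1 := Matrix.isHermitian_conjTranspose_mul_self A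
    have e2 := Matrix.isHermitian_conjTranspose_mul_self Aᵀ
    rw [htt]
    unfold Matrix.IsHermitian at *
    rw [Matrix.conjTranspose_add, Matrix.conjTranspose_smul, Matrix.conjTranspose_sub, e1, e2]
    simp
  have hquad : ∀ (γ : ℝ) (v : EuclideanSpace ℂ (Fin n)),
      (star v.ofLp ⬝ᵥ ((Aᴴᵀ * Aᵀ + γ • (Aᴴ * A - Aᴴᵀ * Aᵀ)) *ᵥ v.ofLp)).re =
        γ * ‖T v‖ ^ 2 + (1 - γ) * ‖S v‖ ^ 2 := by
    intro γ v
    rw [hT, hS, ← aux_quad, ← aux_quad, htt, Matrix.add_mulVec, Matrix.smul_mulVec,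
      Matrix.sub_mulVec, dotProduct_add, dotProduct_smul, dotProduct_sub]
    simp
    ring
  -- lower bound for members
  have hlow : ∀ (D : Matrix (Fin n) (Fin n) ℂ) (v : Fin n → ℂ),
      v ≠ 0 → (A - D).mulVec v = 0 → (Aᵀ - Dᵀ).mulVec v = 0 → ∀ γ ∈ Set.Icc (0 : ℝ) 1,
      lamMin (Aᴴᵀ * Aᵀ + γ • (Aᴴ * A - Aᴴᵀ * Aᵀ)) ≤ specNorm D ^ 2 := by
    intro D v hv h1 h2 γ hγ
    have hle := aux_lamMin_le _ (hherm γ) (WithLp.toLp 2 v)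
    rw [hquad] at hle
    have hv' : (WithLp.toLp 2 v : EuclideanSpace ℂ (Fin n)) ≠ 0 := by
      simpa using hv
    have hpos : 0 < ‖(WithLp.toLp 2 v : EuclideanSpace ℂ (Fin n))‖ ^ 2 := by
      have := norm_pos_iff.2 hv'
      positivity
    rw [Matrix.sub_mulVec, sub_eq_zero] at h1 h2
    have e1 : ‖T (WithLp.toLp 2 v)‖ ≤ specNorm D * ‖(WithLp.toLp 2 v : EuclideanSpace ℂ (Fin n))‖ := by
      have := (Matrix.toEuclideanCLM (𝕜 := ℂ) D).le_opNorm (WithLp.toLp 2 v)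
      rw [aux_clm_apply] at this
      rw [hT, aux_clm_apply]
      simp only [h1]
      exact this
    have e2 : ‖S (WithLp.toLp 2 v)‖ ≤ specNorm D * ‖(WithLp.toLp 2 v : EuclideanSpace ℂ (Fin n))‖ := by
      rw [← aux_specNorm_transpose]
      have := (Matrix.toEuclideanCLM (𝕜 := ℂ) Dᵀ).le_opNorm (WithLp.toLp 2 v)
      rw [aux_clm_apply] at this
      rw [hS, aux_clm_apply]
      simp only [h2]
      exact this
    have e1' := pow_le_pow_left₀ (norm_nonneg _) e1 2
    have e2' := pow_le_pow_left₀ (norm_nonneg _) e2 2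
    rw [mul_pow] at e1' e2'
    have f1 := mul_le_mul_of_nonneg_left e1' hγ.1
    have f2 := mul_le_mul_of_nonneg_left e2' (sub_nonneg.2 hγ.2)
    exact le_of_mul_le_mul_right (by linarith) hpos
  -- upper bound
  have hnonneg : 0 ≤ δ := by
    apply Real.sInf_nonneg
    rintro r ⟨D, v, -, -, -, rfl⟩
    exact Real.sqrt_nonneg _
  have hup : ∀ v : EuclideanSpace ℂ (Fin n), ‖v‖ = 1 →
      δ ^ 2 / 2 ≤ max (‖T v‖ ^ 2) (‖S v‖ ^ 2) := by
    intro v hv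
    obtain ⟨D, hD1, hD2, hD3⟩ := aux_dkw (E := EuclideanSpace ℂ (Fin n))
      (WithLp.toLp 2 (star v.ofLp)) v (T v) (WithLp.toLp 2 (star (S v).ofLp))
      (by rw [aux_norm_star]; exact hv) hv (by
        rw [hT, hS, aux_clm_apply, aux_clm_apply, EuclideanSpace.inner_eq_star_dotProduct,
          EuclideanSpace.inner_eq_star_dotProduct]
        simp only [star_star]
        rw [dotProduct_comm, Matrix.dotProduct_mulVec, dotProduct_comm, Matrix.mulVec_transpose])
    rw [aux_norm_star] at hD3
    obtain ⟨M, hM⟩ : ∃ M : Matrix (Fin n) (Fin n) ℂ, Matrix.toEuclideanCLM (𝕜 := ℂ) M = D :=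
      (Matrix.toEuclideanCLM (n := Fin n) (𝕜 := ℂ)).surjective D
    subst hM
    have hmem : δ ≤ Real.sqrt (specNorm M ^ 2 + specNorm Mᵀ ^ 2) := by
      apply csInf_le
      · refine ⟨0, ?_⟩
        rintro r ⟨D, v, -, -, -, rfl⟩
        exact Real.sqrt_nonneg _
      · refine ⟨M, v.ofLp, ?_, ?_, ?_, rfl⟩
        · intro h0
          have h00 : v = 0 := by ext j; simp [h0]
          rw [h00] at hv
          simp at hv
        · rw [Matrix.sub_mulVec, sub_eq_zero]
          rw [hT, aux_clm_apply, aux_clm_apply] at hD1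
          exact (WithLp.toLp_injective 2 hD1).symm
        · rw [Matrix.sub_mulVec, sub_eq_zero]
          apply dotProduct_eq
          intro w
          have h3 := hD2 (WithLp.toLp 2 w)
          rw [hS, aux_clm_apply, aux_clm_apply, EuclideanSpace.inner_eq_star_dotProduct,
            EuclideanSpace.inner_eq_star_dotProduct] at h3
          simp only [star_star] at h3
          rw [dotProduct_comm, Matrix.dotProduct_mulVec] at h3
          rw [dotProduct_comm, ← h3, Matrix.mulVec_transpose]
    have h4 : δ ^ 2 ≤ specNorm M ^ 2 + specNorm Mᵀ ^ 2 := by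
      have := pow_le_pow_left₀ hnonneg hmem 2
      rwa [Real.sq_sqrt (by positivity)] at this
    rw [aux_specNorm_transpose] at h4
    have h5 : specNorm M ^ 2 ≤ max (‖T v‖ ^ 2) (‖S v‖ ^ 2) := hD3
    linarith
  obtain ⟨v₀, hv₀⟩ : ∃ v : Fin n → ℂ, v ≠ 0 := exists_ne 0
  have hbdd : BddAbove (Set.range fun γ : Set.Icc (0 : ℝ) 1 =>
      lamMin (Aᴴᵀ * Aᵀ + (γ : ℝ) • (Aᴴ * A - Aᴴᵀ * Aᵀ))) := by
    refine ⟨specNorm A ^ 2, ?_⟩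
    rintro _ ⟨γ, rfl⟩
    exact hlow A v₀ hv₀ (by simp) (by simp) γ γ.2
  have : Nonempty (Set.Icc (0 : ℝ) 1) := ⟨⟨0, by simp⟩⟩
  apply le_antisymm
  · obtain ⟨γ, hγ, hm⟩ := aux_minimax S T (δ ^ 2 / 2) hup
    have h1 : δ ^ 2 / 2 ≤ lamMin (Aᴴᵀ * Aᵀ + γ • (Aᴴ * A - Aᴴᵀ * Aᵀ)) :=
      aux_le_lamMin _ (hherm γ) _ fun v => by rw [hquad]; exact hm v
    have h2 := le_ciSup hbdd ⟨γ, hγ⟩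
    simp only at h2
    linarith
  · have h1 : √(2 * ⨆ γ : Set.Icc (0 : ℝ) 1,
        lamMin (Aᴴᵀ * Aᵀ + (γ : ℝ) • (Aᴴ * A - Aᴴᵀ * Aᵀ))) ≤ δ := by
      apply le_csInf
      · exact ⟨_, A, v₀, hv₀, by simp, by simp, rfl⟩
      · rintro r ⟨D, v, hv, h1, h2, rfl⟩
        apply Real.sqrt_le_sqrt
        have := ciSup_le fun γ : Set.Icc (0 : ℝ) 1 => hlow D v hv h1 h2 γ γ.2
        rw [aux_specNorm_transpose]
        linarith
    exact (Real.sqrt_le_left hnonneg).1 h1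
end
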